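/- A morphism f : X → Y of separated metric compact Hausdorff spaces is surjective if and only if it is an epimorphism, i.e., if and only if for every separated metric compact Hausdorff space Z and all morphisms g, h : Y → Z, g ∘ f = h ∘ f implies g = h. -/

import Mathlib

open ENNReal

/-- `d` is a (Lawvere-style) metric: `d x x = 0` and the triangle inequality holds. -/
def IsEMetric {X : Type*} (d : X → X → ℝ≥0∞) : Prop :=
  (∀ x, d x x = 0) ∧ ∀ x y z, d x z ≤ d x y + d y z

/-- `d` is separated: `d x y = 0` and `d y x = 0` imply `x = y`. -/
def IsSepMetric {X : Type*} (d : X → X → ℝ≥0∞) : Prop :=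
  ∀ x y, d x y = 0 → d y x = 0 → x = y

theorem IsClosedMap.t2Space_of_surjective {W Z : Type*} [TopologicalSpace W] [NormalSpace W]
    [T1Space W] [TopologicalSpace Z] {p : W → Z} (hp : Continuous p) (hc : IsClosedMap p)
    (hs : Function.Surjective p) : T2Space Z := by
  have hpt : ∀ z : Z, IsClosed ({z} : Set Z) := fun z => by
    obtain ⟨w, rfl⟩ := hs z
    simpa using hc {w} isClosed_singleton
  refine ⟨fun z z' hne => ?_⟩
  obtain ⟨U, V, hU, hV, hzU, hzV, hUV⟩ := normal_separation ((hpt z).preimage hp)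
    ((hpt z').preimage hp) (Disjoint.preimage p (by simpa using hne))
  have hopen {O : Set W} (hO : IsOpen O) : IsOpen (Set.kernImage p O) :=
    isClosedMap_iff_kernImage.1 hc hO
  refine ⟨_, _, hopen hU, hopen hV, fun w hw => hzU hw, fun w hw => hzV hw, ?_⟩
  refine Set.disjoint_left.2 fun a ha hb => ?_
  obtain ⟨w, rfl⟩ := hs a
  exact Set.disjoint_left.1 hUV (ha rfl) (hb rfl)

theorem lowerSemicontinuous_of_comp_isClosedMap {W Z : Type*} [TopologicalSpace W]
    [TopologicalSpace Z] {p : W → Z} (hc : IsClosedMap p) (hs : Function.Surjective p)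
    {F : Z → ℝ≥0∞} (hF : LowerSemicontinuous (F ∘ p)) : LowerSemicontinuous F := by
  rw [lowerSemicontinuous_iff_isClosed_preimage] at hF ⊢
  intro c
  have := hc _ (hF c)
  rwa [Set.preimage_comp, Set.image_preimage_eq _ hs] at this

theorem exists_iInf_eq_of_lowerSemicontinuous {A : Type*} [TopologicalSpace A] [CompactSpace A]
    [Nonempty A] {F : A → ℝ≥0∞} (hF : LowerSemicontinuous F) : ∃ a, F a = ⨅ a, F a := by
  obtain ⟨a, -, ha⟩ := LowerSemicontinuousOn.exists_isMinOn Set.univ_nonempty isCompact_univ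
    (lowerSemicontinuousOn_univ_iff.2 hF)
  exact ⟨a, le_antisymm (le_iInf fun b => ha (Set.mem_univ b)) (iInf_le _ _)⟩

theorem LowerSemicontinuous.iInf_of_compactSpace {P A : Type*} [TopologicalSpace P]
    [TopologicalSpace A] [CompactSpace A] {F : P × A → ℝ≥0∞} (hF : LowerSemicontinuous F) :
    LowerSemicontinuous fun p => ⨅ a, F (p, a) := by
  cases isEmpty_or_nonempty A
  · simp only [iInf_of_empty]
    exact lowerSemicontinuous_const
  rw [lowerSemicontinuous_iff_isClosed_preimage]
  intro c
  convert isClosedMap_fst_of_compactSpace _ (hF.isClosed_preimage c)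
  ext p
  obtain ⟨a, ha⟩ := exists_iInf_eq_of_lowerSemicontinuous
    (hF.comp (Continuous.prodMk_right p) : LowerSemicontinuous fun a => F (p, a))
  constructor
  · intro h
    exact ⟨(p, a), ha.trans_le h, rfl⟩
  · rintro ⟨⟨_, b⟩, h, rfl⟩
    exact (iInf_le (fun a => F (_, a)) b).trans h

namespace IsEMetric

/-- The equivalence relation identifying points at distance zero in both directions. -/
def setoid {W : Type*} {D : W → W → ℝ≥0∞} (hD : IsEMetric D) : Setoid W where
  r x y := D x y = 0 ∧ D y x = 0
  iseqv :=
    { refl := fun x => ⟨hD.1 x, hD.1 x⟩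
      symm := fun h => ⟨h.2, h.1⟩
      trans := fun {x y z} h k =>
        ⟨le_antisymm ((hD.2 x y z).trans (by simp [h.1, k.1])) zero_le,
          le_antisymm ((hD.2 z y x).trans (by simp [h.2, k.2])) zero_le⟩ }

theorem le_of_eq_zero {W : Type*} {D : W → W → ℝ≥0∞} (hD : IsEMetric D) {x y x' y' : W}
    (hx : D x x' = 0) (hy : D y' y = 0) : D x y ≤ D x' y' := by
  calc D x y ≤ D x x' + (D x' y' + D y' y) :=
        (hD.2 x x' y).trans (add_le_add le_rfl (hD.2 x' y' y))
    _ = D x' y' := by simp [hx, hy]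

/-- The distance induced on the separated quotient. -/
def quotientDist {W : Type*} {D : W → W → ℝ≥0∞} (hD : IsEMetric D) :
    Quotient hD.setoid → Quotient hD.setoid → ℝ≥0∞ :=
  Quotient.lift₂ D fun _ _ _ _ h k =>
    le_antisymm (hD.le_of_eq_zero h.1 k.2) (hD.le_of_eq_zero h.2 k.1)

section

variable {W : Type*} {D : W → W → ℝ≥0∞} (hD : IsEMetric D)

theorem isEMetric_quotientDist : IsEMetric hD.quotientDist := by
  refine ⟨?_, ?_⟩
  · rintro ⟨x⟩
    exact hD.1 x
  · rintro ⟨x⟩ ⟨y⟩ ⟨z⟩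
    exact hD.2 x y z

theorem isSepMetric_quotientDist : IsSepMetric hD.quotientDist := by
  rintro ⟨x⟩ ⟨y⟩ h k
  exact Quotient.sound ⟨h, k⟩

theorem isClosedMap_quotientMk [TopologicalSpace W] [CompactSpace W]
    (hl : LowerSemicontinuous fun p : W × W => D p.1 p.2) :
    IsClosedMap (Quotient.mk hD.setoid) := by
  intro C hC
  rw [← isQuotientMap_quotient_mk'.isClosed_preimage]
  have hl' : LowerSemicontinuous fun p : W × W => D p.2 p.1 := hl.comp continuous_swap
  convert isClosedMap_fst_of_compactSpace _ (((hl.isClosed_preimage 0).inter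
    (hl'.isClosed_preimage 0)).inter (hC.preimage continuous_snd))
  ext x
  constructor
  · rintro ⟨y, hy, h⟩
    obtain ⟨h1, h2⟩ := Quotient.exact h
    exact ⟨(x, y), ⟨⟨h2.le, h1.le⟩, hy⟩, rfl⟩
  · rintro ⟨⟨_, y⟩, ⟨⟨h1, h2⟩, hy⟩, rfl⟩
    exact ⟨y, hy, Quotient.sound ⟨le_antisymm h2 zero_le, le_antisymm h1 zero_le⟩⟩

theorem t2Space_quotient [TopologicalSpace W] [CompactSpace W] [T2Space W]
    (hl : LowerSemicontinuous fun p : W × W => D p.1 p.2) : T2Space (Quotient hD.setoid) :=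
  (hD.isClosedMap_quotientMk hl).t2Space_of_surjective continuous_quotient_mk'
    Quotient.mk_surjective

theorem lowerSemicontinuous_quotientDist [TopologicalSpace W] [CompactSpace W] [T2Space W]
    (hl : LowerSemicontinuous fun p : W × W => D p.1 p.2) :
    LowerSemicontinuous fun p : Quotient hD.setoid × Quotient hD.setoid =>
      hD.quotientDist p.1 p.2 := by
  have := hD.t2Space_quotient hl
  have hc : Continuous (Quotient.mk hD.setoid) := continuous_quotient_mk'
  exact lowerSemicontinuous_of_comp_isClosedMap (hc.prodMap hc).isClosedMap
    (Quotient.mk_surjective.prodMap Quotient.mk_surjective) hl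

end

end IsEMetric

/-- The least distance from `y` to `z` along paths through the range of `f`. -/
noncomputable def distThrough {X Y : Type*} (d : Y → Y → ℝ≥0∞) (f : X → Y) (y z : Y) : ℝ≥0∞ :=
  ⨅ x, (d y (f x) + d (f x) z)

/-- The distance on two copies of `Y` in which passing from one copy to the other goes through
the range of `f`. -/
noncomputable def doubleDist {X Y : Type*} (d : Y → Y → ℝ≥0∞) (f : X → Y) (p q : Y × Bool) :
    ℝ≥0∞ :=
  if p.2 = q.2 then d p.1 q.1 else distThrough d f p.1 q.1

section

variable {X Y : Type*} {d : Y → Y → ℝ≥0∞}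

theorem IsEMetric.le_distThrough (hd : IsEMetric d) (f : X → Y) (y z : Y) :
    d y z ≤ distThrough d f y z :=
  le_iInf fun x => hd.2 y (f x) z

theorem IsEMetric.distThrough_le_dist_add (hd : IsEMetric d) (f : X → Y) (y z w : Y) :
    distThrough d f y w ≤ d y z + distThrough d f z w := by
  simp only [distThrough, ENNReal.add_iInf]
  refine iInf_mono fun x => ?_
  rw [← add_assoc]
  exact add_le_add (hd.2 _ _ _) le_rfl

theorem IsEMetric.distThrough_le_add_dist (hd : IsEMetric d) (f : X → Y) (y z w : Y) :
    distThrough d f y w ≤ distThrough d f y z + d z w := by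
  simp only [distThrough, ENNReal.iInf_add]
  refine iInf_mono fun x => ?_
  rw [add_assoc]
  exact add_le_add le_rfl (hd.2 _ _ _)

theorem IsEMetric.doubleDist (hd : IsEMetric d) (f : X → Y) : IsEMetric (doubleDist d f) := by
  refine ⟨fun p => by simp [_root_.doubleDist, hd.1], ?_⟩
  have hcross (y z w : Y) : d y w ≤ distThrough d f y z + distThrough d f z w :=
    (hd.2 y z w).trans (add_le_add (hd.le_distThrough f y z) (hd.le_distThrough f z w))
  rintro ⟨y, i⟩ ⟨z, j⟩ ⟨w, k⟩
  cases i <;> cases j <;> cases k <;>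
    simp [_root_.doubleDist, hd.2, hcross, hd.distThrough_le_dist_add, hd.distThrough_le_add_dist]

variable [TopologicalSpace X] [TopologicalSpace Y]

theorem lowerSemicontinuous_add_dist (hl : LowerSemicontinuous fun p : Y × Y => d p.1 p.2)
    {f : X → Y} (hf : Continuous f) :
    LowerSemicontinuous fun q : (Y × Y) × X => d q.1.1 (f q.2) + d (f q.2) q.1.2 :=
  LowerSemicontinuous.add
    (hl.comp (by fun_prop : Continuous fun q : (Y × Y) × X => (q.1.1, f q.2)))
    (hl.comp (by fun_prop : Continuous fun q : (Y × Y) × X => (f q.2, q.1.2)))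

variable [CompactSpace X]

theorem lowerSemicontinuous_distThrough (hl : LowerSemicontinuous fun p : Y × Y => d p.1 p.2)
    {f : X → Y} (hf : Continuous f) :
    LowerSemicontinuous fun p : Y × Y => distThrough d f p.1 p.2 :=
  (lowerSemicontinuous_add_dist hl hf).iInf_of_compactSpace

theorem lowerSemicontinuous_doubleDist (hl : LowerSemicontinuous fun p : Y × Y => d p.1 p.2)
    {f : X → Y} (hf : Continuous f) :
    LowerSemicontinuous fun p : (Y × Bool) × (Y × Bool) => doubleDist d f p.1 p.2 := by
  have hπ : Continuous fun p : (Y × Bool) × (Y × Bool) => (p.1.1, p.2.1) := by fun_prop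
  have hβ : Continuous fun p : (Y × Bool) × (Y × Bool) => (p.1.2, p.2.2) := by fun_prop
  rw [lowerSemicontinuous_iff_isClosed_preimage]
  intro c
  convert ((((isClosed_discrete {b : Bool × Bool | b.1 = b.2}).preimage hβ).inter
    ((hl.comp hπ).isClosed_preimage c))).union
    (((isClosed_discrete {b : Bool × Bool | b.1 ≠ b.2}).preimage hβ).inter
      (((lowerSemicontinuous_distThrough hl hf).comp hπ).isClosed_preimage c))
  ext ⟨⟨y, i⟩, z, j⟩
  by_cases h : i = j <;> simp [doubleDist, h]

theorem mem_range_of_distThrough_self_eq_zero (hs : IsSepMetric d)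
    (hl : LowerSemicontinuous fun p : Y × Y => d p.1 p.2) {f : X → Y} (hf : Continuous f) {y : Y}
    (h : distThrough d f y y = 0) : y ∈ Set.range f := by
  cases isEmpty_or_nonempty X
  · rw [distThrough, iInf_of_empty] at h
    exact absurd h top_ne_zero
  obtain ⟨x, hx⟩ := exists_iInf_eq_of_lowerSemicontinuous
    ((lowerSemicontinuous_add_dist hl hf).comp (Continuous.prodMk_right (y, y)))
  obtain ⟨h1, h2⟩ := add_eq_zero.1 (hx.trans h)
  exact ⟨x, hs _ _ h2 h1⟩

end


theorem stmt_10.{u} {X Y : Type u}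
    [TopologicalSpace X] [CompactSpace X] [T2Space X]
    [TopologicalSpace Y] [CompactSpace Y] [T2Space Y]
    (dX : X → X → ℝ≥0∞) (dY : Y → Y → ℝ≥0∞)
    (hX : IsEMetric dX ∧ IsSepMetric dX ∧ LowerSemicontinuous (fun p : X × X => dX p.1 p.2))
    (hY : IsEMetric dY ∧ IsSepMetric dY ∧ LowerSemicontinuous (fun p : Y × Y => dY p.1 p.2))
    -- `f` is a morphism
    (f : X → Y) (hf : Continuous f) (hfne : ∀ x x', dY (f x) (f x') ≤ dX x x') :
    Function.Surjective f ↔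
      ∀ (Z : Type u) [TopologicalSpace Z] [CompactSpace Z] [T2Space Z]
        (dZ : Z → Z → ℝ≥0∞),
        IsEMetric dZ → IsSepMetric dZ →
        LowerSemicontinuous (fun p : Z × Z => dZ p.1 p.2) →
        ∀ g h : Y → Z, Continuous g → Continuous h →
          (∀ y y', dZ (g y) (g y') ≤ dY y y') → (∀ y y', dZ (h y) (h y') ≤ dY y y') →
          g ∘ f = h ∘ f → g = h := by
  constructor
  · intro hs Z _ _ _ dZ _ _ _ g h _ _ _ _ hgh
    exact hs.injective_comp_right hgh
  · intro hepi y
    obtain ⟨hd, hsep, hl⟩ := hY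
    have hD := hd.doubleDist f
    have hDl := lowerSemicontinuous_doubleDist hl hf
    have := hD.t2Space_quotient hDl
    have hcopy (b : Bool) : Continuous fun y : Y => (Quotient.mk hD.setoid (y, b)) :=
      continuous_quotient_mk'.comp (Continuous.prodMk_left b)
    have hdist (b : Bool) (y y' : Y) : hD.quotientDist (Quotient.mk hD.setoid (y, b))
        (Quotient.mk hD.setoid (y', b)) ≤ dY y y' :=
      le_of_eq (if_pos rfl)
    have hglue (x : X) : distThrough dY f (f x) (f x) = 0 :=
      le_antisymm ((iInf_le _ x).trans (by simp [hd.1])) zero_le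
    have heq := hepi _ hD.quotientDist hD.isEMetric_quotientDist hD.isSepMetric_quotientDist
      (hD.lowerSemicontinuous_quotientDist hDl) _ _ (hcopy true) (hcopy false) (hdist true)
      (hdist false) (funext fun x => Quotient.sound
        ⟨by simp [doubleDist, hglue], by simp [doubleDist, hglue]⟩)
    have hy := (Quotient.exact (congrFun heq y)).1
    exact mem_range_of_distThrough_self_eq_zero hsep hl hf (by simpa [doubleDist] using hy)
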